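/- Let d ≥ 1, r > 0, and let P be a probability measure on ℝ^d with ∫|x|^r dP < ∞. Let (a_n)_{n≥1} be an L^r-optimal greedy quantization sequence of P, let ε ∈ (0,1/3), and suppose a probability measure ν and a Borel function g_ε : ℝ^d → (0,∞) satisfy the ball-control criterion at level ε w.r.t. a_1 and P. Then for every c ∈ (0, ε/(1−ε)] with c < 1/2 and every n ≥ 1: e_r(a^{(n)},P)^r − e_r(a^{(n+1)},P)^r ≥ V_d · φ_r(c/(c+1)) · ∫ g_ε(x) · d(x,a^{(n)})^{d+r} dP(x). -/

import Mathlib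

open MeasureTheory Metric Set Real

/-- The `Lʳ`-quantization error `e_r(Γ, P) = (∫ d(x,Γ)^r dP(x))^(1/r)`. -/
noncomputable def qerr {d : ℕ} (r : ℝ) (P : Measure (EuclideanSpace ℝ (Fin d)))
    (Γ : Set (EuclideanSpace ℝ (Fin d))) : ℝ :=
  (∫ x, infDist x Γ ^ r ∂P) ^ (1 / r)

/-- The first `n` points `a^{(n)} = {a_1, …, a_n}` of a sequence `(a_k)_{k ≥ 1}`. -/
def greedyGrid {d : ℕ} (a : ℕ → EuclideanSpace ℝ (Fin d)) (n : ℕ) :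
    Set (EuclideanSpace ℝ (Fin d)) :=
  a '' Set.Icc 1 n

/-- `(a_n)_{n ≥ 1}` is an `Lʳ`-optimal greedy quantization sequence for `P`. -/
def IsGreedySeq {d : ℕ} (r : ℝ) (P : Measure (EuclideanSpace ℝ (Fin d)))
    (a : ℕ → EuclideanSpace ℝ (Fin d)) : Prop :=
  (∀ ξ, ∫ x, dist x (a 1) ^ r ∂P ≤ ∫ x, dist x ξ ^ r ∂P) ∧
    ∀ n, 1 ≤ n → ∀ ξ,
      qerr r P (greedyGrid a (n + 1)) ≤ qerr r P (insert ξ (greedyGrid a n))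

/-- The dilatation `Γ_{θ,μ} = {μ + θ(a - μ) : a ∈ Γ}` of a grid. -/
def dilSet {d : ℕ} (θ : ℝ) (μ : EuclideanSpace ℝ (Fin d))
    (Γ : Set (EuclideanSpace ℝ (Fin d))) : Set (EuclideanSpace ℝ (Fin d)) :=
  (fun a => μ + θ • (a - μ)) '' Γ

/-- The measure `P = f · λ_d`. -/
noncomputable def Pmeas {d : ℕ} (f : EuclideanSpace ℝ (Fin d) → ℝ) :
    Measure (EuclideanSpace ℝ (Fin d)) :=
  volume.withDensity fun x => ENNReal.ofReal (f x)

/-- The dilated measure `P_{θ,μ} = θ^d f_{θ,μ} · λ_d`, with `f_{θ,μ}(x) = f(μ + θ(x-μ))`. -/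
noncomputable def Pdil {d : ℕ} (f : EuclideanSpace ℝ (Fin d) → ℝ) (θ : ℝ)
    (μ : EuclideanSpace ℝ (Fin d)) : Measure (EuclideanSpace ℝ (Fin d)) :=
  volume.withDensity fun x => ENNReal.ofReal (θ ^ (d : ℝ) * f (μ + θ • (x - μ)))

/-- `V_d`, the Lebesgue volume of the Euclidean unit ball of `ℝ^d`. -/
noncomputable def Vd (d : ℕ) : ℝ :=
  (volume (Metric.ball (0 : EuclideanSpace ℝ (Fin d)) 1)).toReal

/-- The (topological) support of a measure on `ℝ^d`. -/
def msupport {d : ℕ} (P : Measure (EuclideanSpace ℝ (Fin d))) :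
    Set (EuclideanSpace ℝ (Fin d)) :=
  {x | ∀ t > 0, 0 < P (Metric.ball x t)}

/-- The ball-control criterion at level `ε` w.r.t. `a₁` and `P`:
`ν(B(x,t)) ≥ g(x) V_d t^d` for every `x ∈ supp P` and `t ∈ [0, ε |x - a₁|]`. -/
def BallControl {d : ℕ} (ε : ℝ) (a₁ : EuclideanSpace ℝ (Fin d))
    (P ν : Measure (EuclideanSpace ℝ (Fin d)))
    (g : EuclideanSpace ℝ (Fin d) → ℝ) : Prop :=
  ∀ x ∈ msupport P, ∀ t ∈ Set.Icc 0 (ε * dist x a₁),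
    ENNReal.ofReal (g x * Vd d * t ^ (d : ℝ)) ≤ ν (closedBall x t)

/-- `φ_r(u) = (3^{-r} - u^r) u^d`. -/
noncomputable def phi (r : ℝ) (d : ℕ) (u : ℝ) : ℝ :=
  ((3 : ℝ) ^ (-r) - u ^ r) * u ^ (d : ℝ)

theorem ae_mem_msupport {d : ℕ} (P : Measure (EuclideanSpace ℝ (Fin d))) :
    ∀ᵐ x ∂P, x ∈ msupport P := by
  filter_upwards [P.support_mem_ae] with x hx t ht
  exact (Measure.mem_support_iff_forall x).1 hx _ (ball_mem_nhds x ht)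

theorem qerr_rpow {d : ℕ} {r : ℝ} (hr : 0 < r) (P : Measure (EuclideanSpace ℝ (Fin d)))
    (Γ : Set (EuclideanSpace ℝ (Fin d))) :
    qerr r P Γ ^ r = ∫ x, infDist x Γ ^ r ∂P := by
  have h : 0 ≤ ∫ x, infDist x Γ ^ r ∂P :=
    integral_nonneg fun x => rpow_nonneg infDist_nonneg r
  rw [qerr, ← rpow_mul h, one_div_mul_cancel hr.ne', rpow_one]

theorem infDist_insert_eq_min {X : Type*} [PseudoMetricSpace X] (x ξ : X) {Γ : Set X}
    (hΓ : Γ.Nonempty) : infDist x (insert ξ Γ) = min (dist x ξ) (infDist x Γ) := by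
  apply le_antisymm
  · exact le_min (infDist_le_dist_of_mem (mem_insert _ _))
      (infDist_le_infDist_of_subset (subset_insert _ _) hΓ)
  · rw [le_infDist (insert_nonempty _ _)]
    rintro y (rfl | hy)
    · exact min_le_left _ _
    · exact (min_le_right _ _).trans (infDist_le_dist_of_mem hy)

theorem integrable_infDist_rpow {d : ℕ} {r : ℝ} (hr : 0 < r)
    (P : Measure (EuclideanSpace ℝ (Fin d))) [IsFiniteMeasure P]
    (hmom : Integrable (fun x => ‖x‖ ^ r) P)
    {Γ : Set (EuclideanSpace ℝ (Fin d))} (hΓ : Γ.Nonempty) :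
    Integrable (fun x => infDist x Γ ^ r) P := by
  obtain ⟨b, hb⟩ := hΓ
  refine ((hmom.add (integrable_const (‖b‖ ^ r))).const_mul (2 ^ r)).mono'
    ((continuous_infDist_pt Γ).rpow_const fun _ => Or.inr hr.le).aestronglyMeasurable
    (ae_of_all _ fun x => ?_)
  rw [norm_of_nonneg (rpow_nonneg infDist_nonneg r)]
  have h1 : infDist x Γ ≤ 2 * max ‖x‖ ‖b‖ := by
    have := infDist_le_dist_of_mem (x := x) hb
    have := dist_le_norm_add_norm x b
    linarith [le_max_left ‖x‖ ‖b‖, le_max_right ‖x‖ ‖b‖]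
  have h2 : (max ‖x‖ ‖b‖) ^ r ≤ ‖x‖ ^ r + ‖b‖ ^ r := by
    rcases max_cases ‖x‖ ‖b‖ with ⟨h, -⟩ | ⟨h, -⟩ <;> rw [h]
    · linarith [rpow_nonneg (norm_nonneg b) r]
    · linarith [rpow_nonneg (norm_nonneg x) r]
  calc infDist x Γ ^ r ≤ (2 * max ‖x‖ ‖b‖) ^ r := rpow_le_rpow infDist_nonneg h1 hr.le
    _ = 2 ^ r * (max ‖x‖ ‖b‖) ^ r := mul_rpow (by norm_num) (by positivity)
    _ ≤ 2 ^ r * (‖x‖ ^ r + ‖b‖ ^ r) := by gcongr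

/-- micro-macro inequality for greedy sequences under the ball-control
criterion. -/
theorem stmt10 (d : ℕ) (hd : 1 ≤ d) (r : ℝ) (hr : 0 < r)
    (P : Measure (EuclideanSpace ℝ (Fin d))) [IsProbabilityMeasure P]
    (hmom : Integrable (fun x => ‖x‖ ^ r) P)
    (a : ℕ → EuclideanSpace ℝ (Fin d)) (ha : IsGreedySeq r P a)
    (ε : ℝ) (hε : ε ∈ Set.Ioo (0 : ℝ) (1 / 3))
    (ν : Measure (EuclideanSpace ℝ (Fin d))) [IsProbabilityMeasure ν]
    (g : EuclideanSpace ℝ (Fin d) → ℝ) (hg_meas : Measurable g) (hg_pos : ∀ x, 0 < g x)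
    (hBC : BallControl ε (a 1) P ν g)
    (c : ℝ) (hc1 : c ∈ Set.Ioc (0 : ℝ) (ε / (1 - ε))) (hc2 : c < 1 / 2)
    (n : ℕ) (hn : 1 ≤ n) :
    Vd d * phi r d (c / (c + 1)) *
        ∫ x, g x * infDist x (greedyGrid a n) ^ ((d : ℝ) + r) ∂P ≤
      qerr r P (greedyGrid a n) ^ r - qerr r P (greedyGrid a (n + 1)) ^ r := by
  set Γ := greedyGrid a n
  set u := c / (c + 1) with hu
  set R := qerr r P Γ ^ r - qerr r P (greedyGrid a (n + 1)) ^ r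
  obtain ⟨hε0, hε1⟩ := hε
  obtain ⟨hc0, hcε⟩ := hc1
  have hu0 : 0 < u := by positivity
  have hu3 : u < 1 / 3 := by
    rw [hu, div_lt_iff₀ (by linarith)]; linarith
  have huε : u ≤ ε := by
    rw [le_div_iff₀ (by linarith)] at hcε
    rw [hu, div_le_iff₀ (by linarith)]; linarith
  have ha1 : a 1 ∈ Γ := ⟨1, ⟨le_rfl, hn⟩, rfl⟩
  have hΓ : Γ.Nonempty := ⟨_, ha1⟩
  have hV : 0 ≤ Vd d := ENNReal.toReal_nonneg
  have hphi : 0 ≤ phi r d u := by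
    have h : u ^ r ≤ (3 : ℝ) ^ (-r) := by
      rw [rpow_neg (by norm_num), ← inv_rpow (by norm_num)]
      exact rpow_le_rpow hu0.le (by linarith) hr.le
    exact mul_nonneg (sub_nonneg.2 h) (by positivity)
  have hphi' : phi r d u ≤ (1 - u ^ r) * u ^ (d : ℝ) := by
    unfold phi
    gcongr
    exact rpow_le_one_of_one_le_of_nonpos (by norm_num) (by linarith)
  have hu1 : 0 ≤ 1 - u ^ r := sub_nonneg.2 (rpow_le_one hu0.le (by linarith) hr.le)
  let F : EuclideanSpace ℝ (Fin d) → EuclideanSpace ℝ (Fin d) → ENNReal := fun x ξ =>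
    ENNReal.ofReal (infDist x Γ ^ r - (min (dist x ξ) (infDist x Γ)) ^ r)
  have hFm : Measurable (Function.uncurry F) := by
    have h1 : Continuous fun p : EuclideanSpace ℝ (Fin d) × EuclideanSpace ℝ (Fin d) =>
        infDist p.1 Γ := (continuous_infDist_pt Γ).comp continuous_fst
    have h2 : Continuous fun p : EuclideanSpace ℝ (Fin d) × EuclideanSpace ℝ (Fin d) =>
        min (dist p.1 p.2) (infDist p.1 Γ) := continuous_dist.min h1
    exact (ENNReal.continuous_ofReal.comp ((h1.rpow_const fun _ => Or.inr hr.le).sub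
      (h2.rpow_const fun _ => Or.inr hr.le))).measurable
  have gain_le (ξ : EuclideanSpace ℝ (Fin d)) : ∫⁻ x, F x ξ ∂P ≤ ENNReal.ofReal R := by
    have i1 := integrable_infDist_rpow hr P hmom hΓ
    have i2 := integrable_infDist_rpow hr P hmom (insert_nonempty ξ Γ)
    have hF : ∀ x, F x ξ =
        ENNReal.ofReal (infDist x Γ ^ r - infDist x (insert ξ Γ) ^ r) := fun x => by
      simp only [F, infDist_insert_eq_min x ξ hΓ]
    simp_rw [hF]
    have i3 : Integrable (fun x => infDist x Γ ^ r - infDist x (insert ξ Γ) ^ r) P := i1.sub i2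
    rw [← ofReal_integral_eq_lintegral_ofReal i3, integral_sub i1 i2,
      ← qerr_rpow hr, ← qerr_rpow hr]
    · refine ENNReal.ofReal_le_ofReal (sub_le_sub_left (rpow_le_rpow ?_ (ha.2 n hn ξ) hr.le) _)
      exact rpow_nonneg (integral_nonneg fun x => rpow_nonneg infDist_nonneg r) _
    · exact ae_of_all _ fun x => sub_nonneg.2 (rpow_le_rpow infDist_nonneg
        (infDist_le_infDist_of_subset (subset_insert _ _) hΓ) hr.le)
  have ball_le : ∀ᵐ x ∂P,
      ENNReal.ofReal (Vd d * phi r d u * (g x * infDist x Γ ^ ((d : ℝ) + r))) ≤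
        ∫⁻ ξ, F x ξ ∂ν := by
    filter_upwards [ae_mem_msupport P] with x hx
    have hD : 0 ≤ infDist x Γ := infDist_nonneg
    have hg := (hg_pos x).le
    set D := infDist x Γ
    have hν := hBC x hx (u * D) ⟨by positivity,
      mul_le_mul huε (infDist_le_dist_of_mem ha1) hD hε0.le⟩
    calc ENNReal.ofReal (Vd d * phi r d u * (g x * D ^ ((d : ℝ) + r)))
        ≤ ENNReal.ofReal (Vd d * ((1 - u ^ r) * u ^ (d : ℝ)) * (g x * D ^ ((d : ℝ) + r))) := by
          gcongr
      _ = ENNReal.ofReal ((1 - u ^ r) * D ^ r) *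
            ENNReal.ofReal (g x * Vd d * (u * D) ^ (d : ℝ)) := by
          rw [← ENNReal.ofReal_mul (by positivity), mul_rpow hu0.le hD,
            rpow_add_of_nonneg hD (by positivity) hr.le]
          ring_nf
      _ ≤ ENNReal.ofReal ((1 - u ^ r) * D ^ r) * ν (closedBall x (u * D)) := by gcongr
      _ = ∫⁻ _ in closedBall x (u * D), ENNReal.ofReal ((1 - u ^ r) * D ^ r) ∂ν := by
          rw [setLIntegral_const]
      _ ≤ ∫⁻ ξ in closedBall x (u * D), F x ξ ∂ν := by
          refine setLIntegral_mono' measurableSet_closedBall fun ξ hξ => ?_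
          refine ENNReal.ofReal_le_ofReal ?_
          rw [sub_mul, one_mul, ← mul_rpow hu0.le hD]
          refine sub_le_sub_left (rpow_le_rpow (le_min dist_nonneg hD) ?_ hr.le) _
          exact (min_le_left _ _).trans (by rwa [mem_closedBall'] at hξ)
      _ ≤ ∫⁻ ξ, F x ξ ∂ν := setLIntegral_le_lintegral _ _
  have key : ∫⁻ x, ENNReal.ofReal (Vd d * phi r d u * (g x * infDist x Γ ^ ((d : ℝ) + r))) ∂P ≤
      ENNReal.ofReal R :=
    calc _ ≤ ∫⁻ x, ∫⁻ ξ, F x ξ ∂ν ∂P := lintegral_mono_ae ball_le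
      _ = ∫⁻ ξ, ∫⁻ x, F x ξ ∂P ∂ν := lintegral_lintegral_swap hFm.aemeasurable
      _ ≤ ∫⁻ _, ENNReal.ofReal R ∂ν := lintegral_mono gain_le
      _ = ENNReal.ofReal R := by simp
  have hR0 : 0 ≤ R := by
    have h := ha.2 n hn (a 1)
    rw [insert_eq_of_mem ha1] at h
    refine sub_nonneg.2 (rpow_le_rpow ?_ h hr.le)
    exact rpow_nonneg (integral_nonneg fun x => rpow_nonneg infDist_nonneg r) _
  rw [← integral_const_mul, integral_eq_lintegral_of_nonneg_ae]
  · exact ENNReal.toReal_le_of_le_ofReal hR0 key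
  · exact ae_of_all _ fun x => mul_nonneg (mul_nonneg hV hphi)
      (mul_nonneg (hg_pos x).le (rpow_nonneg infDist_nonneg _))
  · exact ((hg_meas.mul ((measurable_infDist (s := Γ)).pow_const _)).const_mul
      _).aestronglyMeasurable
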